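/- Let M be a nonsingular symmetric n×n real matrix, u ∈ ℝⁿ a vector, and c > 0 a real number, and suppose that M' = M + c·uuᵀ is also nonsingular. Then σ(M') = σ(M) or σ(M') = σ(M) + 2. -/

import Mathlib

open Matrix

/-- The sign of a real number, as an integer. -/
noncomputable def sgn (x : ℝ) : ℤ :=
  if 0 < x then 1 else if x < 0 then -1 else 0

/-- The signature of a real symmetric (Hermitian) matrix: the number of positive
eigenvalues minus the number of negative eigenvalues, counted with multiplicity
(junk value 0 if the matrix is not Hermitian). -/
noncomputable def signature {m : Type*} [Fintype m] [DecidableEq m]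
    (M : Matrix m m ℝ) : ℤ :=
  if hM : M.IsHermitian then
    ((Finset.univ.filter fun i => 0 < hM.eigenvalues i).card : ℤ) -
      ((Finset.univ.filter fun i => hM.eigenvalues i < 0).card : ℤ)
  else 0

open QuadraticForm QuadraticMap

theorem Matrix.toQuadraticForm'_apply {m R : Type*} [Fintype m] [DecidableEq m] [CommRing R]
    (A : Matrix m m R) (x : m → R) : A.toQuadraticForm' x = x ⬝ᵥ A *ᵥ x := by
  simp [Matrix.toQuadraticForm', Matrix.toLinearMap₂'_apply']

theorem Matrix.IsHermitian.toQuadraticForm'_equivalent {m : Type*} [Fintype m] [DecidableEq m]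
    {A : Matrix m m ℝ} (hA : A.IsHermitian) :
    A.toQuadraticForm'.Equivalent (weightedSumSquares ℝ hA.eigenvalues) := by
  refine QuadraticMap.Equivalent.symm
    ⟨⟨Matrix.UnitaryGroup.toLinearEquiv hA.eigenvectorUnitary, fun y => ?_⟩⟩
  have h : (hA.eigenvectorUnitary : Matrix m m ℝ)ᵀ * A * hA.eigenvectorUnitary =
      diagonal hA.eigenvalues := by
    simpa [Unitary.conjStarAlgAut_star_apply, star_eq_conjTranspose, Function.comp_def] using
      hA.conjStarAlgAut_star_eigenvectorUnitary
  change A.toQuadraticForm' ((hA.eigenvectorUnitary : Matrix m m ℝ) *ᵥ y) = _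
  rw [toQuadraticForm'_apply, mulVec_mulVec, ← vecMul_transpose, ← dotProduct_mulVec,
    mulVec_mulVec, ← mul_assoc, h, weightedSumSquares_apply]
  simp only [dotProduct, mulVec_diagonal, smul_eq_mul]
  exact Finset.sum_congr rfl fun i _ => by ring

theorem sigPos_mono {E : Type*} [AddCommGroup E] [Module ℝ E] [FiniteDimensional ℝ E]
    {Q Q' : QuadraticForm ℝ E} (h : ∀ x, Q x ≤ Q' x) : sigPos Q ≤ sigPos Q' := by
  obtain ⟨V, hV, hpos⟩ := exists_finrank_eq_sigPos_and_posDef Q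
  rw [← hV]
  exact le_sigPos_of_posDef Q' fun x hx => (hpos x hx).trans_le (h x)

theorem sigPos_le_succ_of_eq_on_ker {E : Type*} [AddCommGroup E] [Module ℝ E]
    [FiniteDimensional ℝ E] {Q Q' : QuadraticForm ℝ E} (f : Module.Dual ℝ E)
    (h : ∀ x, f x = 0 → Q' x = Q x) : sigPos Q' ≤ sigPos Q + 1 := by
  obtain ⟨V, hV, hpos⟩ := exists_finrank_eq_sigPos_and_posDef Q'
  have hW : (Q.restrict (V ⊓ LinearMap.ker f)).PosDef := by
    intro x hx
    have h' := hpos ⟨x, x.2.1⟩ fun h0 =>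
      hx (Subtype.ext (Subtype.ext_iff.mp h0 :))
    rw [restrict_apply] at h' ⊢
    exact h'.trans_eq (h x x.2.2)
  have hle := le_sigPos_of_posDef Q hW
  have hsup := Submodule.finrank_sup_add_finrank_inf_eq V (LinearMap.ker f)
  have hker := f.finrank_range_add_finrank_ker
  have hrange : Module.finrank ℝ (LinearMap.range f) ≤ 1 := by
    simpa using (LinearMap.range f).finrank_le
  have := (V ⊔ LinearMap.ker f).finrank_le
  omega

theorem signature_eq_two_mul_sigPos_sub_card {m : Type*} [Fintype m] [DecidableEq m]
    {A : Matrix m m ℝ} (hA : A.IsHermitian) (hdet : A.det ≠ 0) :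
    signature A = 2 * sigPos A.toQuadraticForm' - Fintype.card m := by
  have hne (i : m) : hA.eigenvalues i ≠ 0 := by
    rw [hA.det_eq_prod_eigenvalues] at hdet
    simpa using Finset.prod_ne_zero_iff.mp hdet i (Finset.mem_univ i)
  have hsig := sigPos_of_equiv_weightedSumSquares hA.toQuadraticForm'_equivalent
  rw [Set.ncard_eq_toFinset_card', Set.toFinset_ofPred] at hsig
  have hneg : (Finset.univ.filter fun i => hA.eigenvalues i < 0) =
      Finset.univ.filter fun i => ¬ 0 < hA.eigenvalues i :=
    Finset.filter_congr fun i _ => by simpa using (hne i).le_iff_lt.symm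
  have hcard := Finset.card_filter_add_card_filter_not (s := Finset.univ)
    fun i => 0 < hA.eigenvalues i
  rw [Finset.card_univ] at hcard
  rw [signature, dif_pos hA, hneg, hsig]
  omega

/-- if M is a nonsingular symmetric n×n real matrix, u a vector, c > 0, and
M' = M + c·uuᵀ is also nonsingular, then σ(M') = σ(M) or σ(M') = σ(M) + 2. -/
theorem signature_rank_one_update {n : ℕ}
    (M : Matrix (Fin n) (Fin n) ℝ) (hM : M.IsSymm) (hMdet : M.det ≠ 0)
    (u : Fin n → ℝ) (c : ℝ) (hc : 0 < c)
    (hM'det : (M + c • vecMulVec u u).det ≠ 0) :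
    signature (M + c • vecMulVec u u) = signature M ∨
      signature (M + c • vecMulVec u u) = signature M + 2 := by
  have hM' : (M + c • vecMulVec u u).IsSymm :=
    hM.add (IsSymm.smul (transpose_vecMulVec u u) c)
  have happly (x : Fin n → ℝ) : (M + c • vecMulVec u u).toQuadraticForm' x =
      M.toQuadraticForm' x + c * (u ⬝ᵥ x) ^ 2 := by
    simp only [toQuadraticForm'_apply, add_mulVec, smul_mulVec, vecMulVec_mulVec, dotProduct_add,
      dotProduct_smul, dotProduct_comm x u, smul_eq_mul, op_smul_eq_smul]
    ring
  have hlow : sigPos M.toQuadraticForm' ≤ sigPos (M + c • vecMulVec u u).toQuadraticForm' :=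
    sigPos_mono fun x => by rw [happly]; exact le_add_of_nonneg_right (by positivity)
  have hup : sigPos (M + c • vecMulVec u u).toQuadraticForm' ≤ sigPos M.toQuadraticForm' + 1 :=
    sigPos_le_succ_of_eq_on_ker (dotProductBilin ℝ ℝ u) fun x hx => by
      rw [dotProductBilin_apply_apply] at hx
      simp [happly, hx]
  rw [signature_eq_two_mul_sigPos_sub_card (A := M) (isHermitian_iff_isSymm.mpr hM) hMdet,
    signature_eq_two_mul_sigPos_sub_card (isHermitian_iff_isSymm.mpr hM') hM'det]
  omega
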